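/- Let α ∈ IF_n satisfy xα ≡ x (mod 2) for all x ∈ dom α. Let A₁ < A₂ < ⋯ < A_p be the maximal blocks of consecutive integers of dom α, listed in increasing order, and let B_j = A_jα for each j. Let i ∈ {1, …, p} and assume that either i = 1, or both of the following hold: xα = x for all x ∈ A₁ ∪ ⋯ ∪ A_{i−1}, and every element of A_{i−1} is smaller than every element of B_l for all l ∈ {i, …, p}. Then there exist ω₁, ω₂ ∈ ⟨J⟩ with ω₁⁻¹, ω₂⁻¹ ∈ ⟨J⟩, dom α ⊆ im ω₁, and im α ⊆ dom ω₂, such that β := ω₁αω₂ ∈ IF_n satisfies: xβ ≡ x (mod 2) for all x ∈ dom β; the maximal blocks of dom β, in increasing order, are A₁ < ⋯ < A_{i−1} < A_i′ < ⋯ < A_p′ (p blocks in total); if i > 1 then xβ = x for all x ∈ A₁ ∪ ⋯ ∪ A_{i−1} and no maximal block of im β lies strictly between A_{i−1} and B_i′ := A_i′β; and every element of B_i′ is smaller than every element of B_l′ := A_l′β for all l ∈ {i+1, …, p}. -/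

import Mathlib

/-!
Common framework: partial injections on `X_n = {1, …, n}`, the fence order,
fence-preserving partial injections, the semigroups `PFI_n`, `IF_n`,
the set `J` of elements of rank at least `n - 2`, and (for even `n`)
the generating system `G`.
-/

namespace FencePaper

/-- The fence (zigzag) order on `{1, …, n}`: `a <_f b` iff `|a - b| = 1` and `b` is even. -/
def fenceLt (a b : ℕ) : Prop := (a + 1 = b ∨ b + 1 = a) ∧ Even b

/-- A partial injection of `X_n = {1, …, n}`, given by its graph. -/
structure PartialInj (n : ℕ) where
  graph : Set (ℕ × ℕ)
  mem_le : ∀ p ∈ graph, 1 ≤ p.1 ∧ p.1 ≤ n ∧ 1 ≤ p.2 ∧ p.2 ≤ n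
  functional : ∀ p ∈ graph, ∀ q ∈ graph, p.1 = q.1 → p.2 = q.2
  injOn : ∀ p ∈ graph, ∀ q ∈ graph, p.2 = q.2 → p.1 = q.1

namespace PartialInj

variable {n : ℕ}

theorem ext' {α β : PartialInj n} (h : α.graph = β.graph) : α = β := by
  cases α
  cases β
  simp only at h
  subst h
  rfl

/-- The domain of a partial injection. -/
def dom (α : PartialInj n) : Set ℕ := {x | ∃ y, (x, y) ∈ α.graph}

/-- The image (range) of a partial injection. -/
def im (α : PartialInj n) : Set ℕ := {y | ∃ x, (x, y) ∈ α.graph}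

/-- The rank of a partial injection: the cardinality of its image. -/
noncomputable def rank (α : PartialInj n) : ℕ := α.im.ncard

/-- The inverse partial injection. -/
def inv (α : PartialInj n) : PartialInj n where
  graph := {p | (p.2, p.1) ∈ α.graph}
  mem_le := by
    rintro p hp
    obtain ⟨h1, h2, h3, h4⟩ := α.mem_le _ hp
    exact ⟨h3, h4, h1, h2⟩
  functional := by
    rintro p hp q hq h
    exact α.injOn _ hp _ hq h
  injOn := by
    rintro p hp q hq h
    exact α.functional _ hp _ hq h

/-- Composition: first `α`, then `β` (maps act on the right). -/
def comp (α β : PartialInj n) : PartialInj n where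
  graph := {p | ∃ y, (p.1, y) ∈ α.graph ∧ (y, p.2) ∈ β.graph}
  mem_le := by
    rintro p ⟨y, h1, h2⟩
    obtain ⟨a, b, -, -⟩ := α.mem_le _ h1
    obtain ⟨-, -, c, d⟩ := β.mem_le _ h2
    exact ⟨a, b, c, d⟩
  functional := by
    rintro p ⟨y, h1, h2⟩ q ⟨z, h3, h4⟩ h
    have hyz : y = z := α.functional _ h1 _ h3 h
    subst hyz
    exact β.functional (y, p.2) h2 (y, q.2) h4 rfl
  injOn := by
    rintro p ⟨y, h1, h2⟩ q ⟨z, h3, h4⟩ h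
    have hyz : y = z := β.injOn _ h2 _ h4 h
    subst hyz
    exact α.injOn (p.1, y) h1 (q.1, y) h3 rfl

/-- The partial identity map on `D ∩ {1, …, n}`. -/
def pid (n : ℕ) (D : Set ℕ) : PartialInj n where
  graph := {p | p.1 ∈ Set.Icc 1 n ∧ p.1 ∈ D ∧ p.2 = p.1}
  mem_le := by
    rintro p ⟨⟨h1, h2⟩, -, h3⟩
    refine ⟨h1, h2, ?_, ?_⟩ <;> omega
  functional := by
    rintro p ⟨-, -, h1⟩ q ⟨-, -, h2⟩ h
    rw [h1, h2, h]
  injOn := by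
    rintro p ⟨-, -, h1⟩ q ⟨-, -, h2⟩ h
    rw [← h1, ← h2, h]

instance : Monoid (PartialInj n) where
  mul := comp
  one := pid n (Set.Icc 1 n)
  mul_assoc a b c := by
    apply ext'
    ext q
    constructor
    · rintro ⟨y, ⟨z, h1, h2⟩, h3⟩
      exact ⟨z, h1, y, h2, h3⟩
    · rintro ⟨z, h1, y, h2, h3⟩
      exact ⟨y, ⟨z, h1, h2⟩, h3⟩
  one_mul a := by
    apply ext'
    ext q
    constructor
    · rintro ⟨y, ⟨-, -, h⟩, h2⟩
      have hy : y = q.1 := h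
      rw [hy] at h2
      exact h2
    · intro hq
      obtain ⟨h1, h2, -, -⟩ := a.mem_le _ hq
      exact ⟨q.1, ⟨⟨h1, h2⟩, ⟨h1, h2⟩, rfl⟩, hq⟩
  mul_one a := by
    apply ext'
    ext q
    constructor
    · rintro ⟨y, h1, ⟨-, -, h⟩⟩
      have hy : q.2 = y := h
      rw [← hy] at h1
      exact h1
    · intro hq
      obtain ⟨-, -, h3, h4⟩ := a.mem_le _ hq
      exact ⟨q.2, hq, ⟨h3, h4⟩, ⟨h3, h4⟩, rfl⟩

theorem mul_graph (α β : PartialInj n) :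
    (α * β).graph = {p | ∃ y, (p.1, y) ∈ α.graph ∧ (y, p.2) ∈ β.graph} := rfl

/-- `α` is fence-preserving. -/
def FP (α : PartialInj n) : Prop :=
  ∀ p ∈ α.graph, ∀ q ∈ α.graph, fenceLt p.1 q.1 → fenceLt p.2 q.2

/-- The image of a subset under a partial injection. -/
def imageOf (α : PartialInj n) (S : Set ℕ) : Set ℕ := {y | ∃ x ∈ S, (x, y) ∈ α.graph}

end PartialInj

open PartialInj

/-- `PFI_n`: the semigroup of all fence-preserving partial injections. -/
def PFIset (n : ℕ) : Set (PartialInj n) := {α | α.FP}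

/-- `IF_n = {α ∈ PFI_n : α⁻¹ ∈ PFI_n}`. -/
def IFset (n : ℕ) : Set (PartialInj n) := {α | α.FP ∧ α.inv.FP}

/-- `J = {α ∈ IF_n : rank α ≥ n - 2}`. -/
def Jset (n : ℕ) : Set (PartialInj n) := {α | α ∈ IFset n ∧ n - 2 ≤ α.rank}

/-- `A` is a maximal block of consecutive integers of `D ⊆ {1, …, n}`. -/
def IsBlock (n : ℕ) (D A : Set ℕ) : Prop :=
  ∃ i r : ℕ, 1 ≤ i ∧ A = Set.Icc i (i + r) ∧ A ⊆ D ∧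
    (i = 1 ∨ i - 1 ∉ D) ∧ (i + r = n ∨ i + r + 1 ∉ D)

/-- `α(k)`: the maximal blocks of `dom α` of cardinality `k`. -/
def blockSet {n : ℕ} (α : PartialInj n) (k : ℕ) : Set (Set ℕ) :=
  {A | IsBlock n α.dom A ∧ A.ncard = k}

/-- `α°(2k+1)`: the maximal blocks `{i, …, i+2k}` of `dom α` with `i` odd. -/
def oddBlockSet {n : ℕ} (α : PartialInj n) (k : ℕ) : Set (Set ℕ) :=
  {A | A ∈ blockSet α (2 * k + 1) ∧ Odd (sInf A)}

/-- The graph of `σ₁`: domain `X_n ∖ {2}`, `1 ↦ n`, `x ↦ x - 2` for `3 ≤ x ≤ n`. -/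
def sigma1Graph (n : ℕ) : Set (ℕ × ℕ) :=
  {q | 1 ≤ q.1 ∧ q.1 ≤ n ∧ q.1 ≠ 2 ∧ q.2 = if q.1 = 1 then n else q.1 - 2}

/-- The graph of `σ₂ = σ₁⁻¹`: domain `X_n ∖ {n-1}`, `x ↦ x + 2` for `x ≤ n - 2`, `n ↦ 1`. -/
def sigma2Graph (n : ℕ) : Set (ℕ × ℕ) :=
  {q | 1 ≤ q.1 ∧ q.1 ≤ n ∧ q.1 ≠ n - 1 ∧ q.2 = if q.1 = n then 1 else q.1 + 2}

/-- The graph of `γ_i`: domain `X_n ∖ {i}`, `x ↦ i - x` for `x < i`, `x ↦ x` for `x > i`. -/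
def gammaGraph (n i : ℕ) : Set (ℕ × ℕ) :=
  {q | 1 ≤ q.1 ∧ q.1 ≤ n ∧ q.1 ≠ i ∧ q.2 = if q.1 < i then i - q.1 else q.1}

/-- The graph of `δ_i`: domain `X_n ∖ {i}`, `x ↦ x` for `x < i`, `x ↦ n + i + 1 - x` for `x > i`. -/
def deltaGraph (n i : ℕ) : Set (ℕ × ℕ) :=
  {q | 1 ≤ q.1 ∧ q.1 ≤ n ∧ q.1 ≠ i ∧ q.2 = if q.1 < i then q.1 else n + i + 1 - q.1}

/-- The graph of `β_{i,j}`: domain `X_n ∖ {i, j}`, reversing the interval strictly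
between `i` and `j` and fixing everything else. -/
def betaGraph (n i j : ℕ) : Set (ℕ × ℕ) :=
  {q | 1 ≤ q.1 ∧ q.1 ≤ n ∧ q.1 ≠ i ∧ q.1 ≠ j ∧
    q.2 = if i < q.1 ∧ q.1 < j then i + j - q.1 else q.1}

/-- The generating system `G` (for even `n`), given elements `σ₁, σ₂` and families
`γ, δ` realizing the prescribed graphs. -/
def Gset (n : ℕ) (σ₁ σ₂ : PartialInj n) (γ δ : ℕ → PartialInj n) : Set (PartialInj n) :=
  {pid n (Set.Icc 1 n), σ₁, σ₂} ∪
    {g | ∃ i, Even i ∧ 4 ≤ i ∧ i ≤ n ∧ g = γ i} ∪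
    {g | ∃ i, Odd i ∧ i ≤ n - 3 ∧ g = δ i}

/-- The reversal of the open interval `(u, v)`, as a function on `ℕ`. -/
def reverseBetween (u v x : ℕ) : ℕ := if u < x ∧ x < v then u + v - x else x

theorem reverseBetween_involutive (u v : ℕ) : Function.Involutive (reverseBetween u v) := by
  intro x
  unfold reverseBetween
  split_ifs <;> omega

/-- The partial injection `β_{u,v}`, with the degenerate choices `u = 0` and `v = n + 1` allowed. -/
def reversal (n u v : ℕ) (hv : v ≤ n + 1) : PartialInj n where
  graph := betaGraph n u v
  mem_le := by
    rintro ⟨x, y⟩ ⟨h1, h2, h3, h4, h5⟩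
    simp only at *
    split_ifs at h5 <;> omega
  functional := by
    rintro ⟨x, y⟩ ⟨h1, h2, h3, h4, h5⟩ ⟨x', y'⟩ ⟨h1', h2', h3', h4', h5'⟩ h
    simp only at *
    subst h
    rw [h5, h5']
  injOn := by
    rintro ⟨x, y⟩ ⟨h1, h2, h3, h4, h5⟩ ⟨x', y'⟩ ⟨h1', h2', h3', h4', h5'⟩ h
    simp only at *
    split_ifs at h5 h5' <;> omega

theorem mem_reversal {n u v : ℕ} {hv : v ≤ n + 1} {x y : ℕ} :
    (x, y) ∈ (reversal n u v hv).graph ↔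
      1 ≤ x ∧ x ≤ n ∧ x ≠ u ∧ x ≠ v ∧ y = reverseBetween u v x := Iff.rfl

theorem reversal_inv {n u v : ℕ} (hv : v ≤ n + 1) :
    (reversal n u v hv).inv = reversal n u v hv := by
  apply ext'
  ext ⟨x, y⟩
  change (y, x) ∈ (reversal n u v hv).graph ↔ (x, y) ∈ (reversal n u v hv).graph
  simp only [mem_reversal, reverseBetween]
  constructor <;> rintro ⟨h1, h2, h3, h4, h5⟩ <;> split_ifs at h5 ⊢ <;> omega

theorem reversal_FP {n u v : ℕ} (hv : v ≤ n + 1) (huv : u % 2 = v % 2) :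
    (reversal n u v hv).FP := by
  rintro ⟨x, y⟩ hp ⟨x', y'⟩ hq
  simp only [mem_reversal, reverseBetween] at hp hq
  obtain ⟨h1, h2, h3, h4, h5⟩ := hp
  obtain ⟨h1', h2', h3', h4', h5'⟩ := hq
  simp only [fenceLt, Nat.even_iff]
  rintro ⟨h6, h7⟩
  split_ifs at h5 h5' <;> omega

theorem reversal_mem_Jset {n u v : ℕ} (hv : v ≤ n + 1) (huv : u % 2 = v % 2) :
    reversal n u v hv ∈ Jset n := by
  refine ⟨⟨reversal_FP hv huv, ?_⟩, ?_⟩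
  · rw [reversal_inv]
    exact reversal_FP hv huv
  · have him : (reversal n u v hv).im = ((Finset.Icc 1 n \ {u, v} : Finset ℕ) : Set ℕ) := by
      ext y
      simp only [im, mem_reversal, reverseBetween, Set.mem_ofPred_eq, Finset.coe_sdiff, Finset.coe_Icc,
        Finset.coe_insert, Finset.coe_singleton, Set.mem_sdiff, Set.mem_Icc, Set.mem_insert_iff,
        Set.mem_singleton_iff]
      constructor
      · rintro ⟨x, h1, h2, h3, h4, h5⟩
        split_ifs at h5 <;> omega
      · rintro ⟨h1, h2⟩
        refine ⟨reverseBetween u v y, ?_⟩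
        unfold reverseBetween
        split_ifs <;> omega
    unfold rank
    rw [him, Set.ncard_coe_finset]
    have h1 := Finset.le_card_sdiff ({u, v} : Finset ℕ) (Finset.Icc 1 n)
    have h2 : ({u, v} : Finset ℕ).card ≤ 2 := Finset.card_le_two
    simp only [Nat.card_Icc] at h1
    omega

theorem one_mem_Jset (n : ℕ) : (1 : PartialInj n) ∈ Jset n := by
  have h : (1 : PartialInj n) = reversal n 0 0 (Nat.zero_le _) := by
    apply ext'
    ext ⟨x, y⟩
    rw [mem_reversal]
    change (x ∈ Set.Icc 1 n ∧ x ∈ Set.Icc 1 n ∧ y = x) ↔ _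
    simp only [reverseBetween, Set.mem_Icc]
    split_ifs <;> omega
  rw [h]
  exact reversal_mem_Jset _ rfl

theorem inv_one (n : ℕ) : (1 : PartialInj n).inv = 1 := by
  apply ext'
  ext ⟨x, y⟩
  change (y ∈ Set.Icc 1 n ∧ y ∈ Set.Icc 1 n ∧ x = y) ↔
    (x ∈ Set.Icc 1 n ∧ x ∈ Set.Icc 1 n ∧ y = x)
  simp only [Set.mem_Icc]
  omega

theorem inv_mul {n : ℕ} (α β : PartialInj n) : (α * β).inv = β.inv * α.inv := by
  apply ext'
  ext ⟨x, y⟩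
  constructor <;> rintro ⟨z, h1, h2⟩ <;> exact ⟨z, h2, h1⟩

theorem FP_mul {n : ℕ} {α β : PartialInj n} (hα : α.FP) (hβ : β.FP) : (α * β).FP := by
  rintro p ⟨y, h1, h2⟩ q ⟨z, h3, h4⟩ h
  exact hβ (y, p.2) h2 (z, q.2) h4 (hα (p.1, y) h1 (q.1, z) h3 h)

theorem mul_mem_IFset {n : ℕ} {α β : PartialInj n} (hα : α ∈ IFset n) (hβ : β ∈ IFset n) :
    α * β ∈ IFset n := by
  refine ⟨FP_mul hα.1 hβ.1, ?_⟩
  rw [inv_mul]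
  exact FP_mul hβ.2 hα.2

/-- `A 1 < ⋯ < A p` is the list of all maximal blocks of `D`. -/
structure BlockEnum (n : ℕ) (D : Set ℕ) (p : ℕ) (A : ℕ → Set ℕ) : Prop where
  isBlock : ∀ j, 1 ≤ j → j ≤ p → IsBlock n D (A j)
  mono : ∀ j j', 1 ≤ j → j < j' → j' ≤ p → ∀ a ∈ A j, ∀ b ∈ A j', a < b
  cover : ∀ C, IsBlock n D C → ∃ j, 1 ≤ j ∧ j ≤ p ∧ C = A j

theorem exists_isBlock_mem {n : ℕ} {D : Set ℕ} (hD : D ⊆ Set.Icc 1 n) {x : ℕ} (hx : x ∈ D) :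
    ∃ C, IsBlock n D C ∧ x ∈ C := by
  classical
  have hlo : ∃ a, a ≤ x ∧ Set.Icc a x ⊆ D :=
    ⟨x, le_rfl, fun z hz => by rwa [le_antisymm hz.2 hz.1]⟩
  have hhi : ∃ b, x ≤ b ∧ b + 1 ∉ D :=
    ⟨max x n, le_max_left _ _, fun h => by have := (hD h).2; omega⟩
  set a := Nat.find hlo
  set b := Nat.find hhi
  obtain ⟨ha, haD⟩ := Nat.find_spec hlo
  obtain ⟨hb, hbD⟩ := Nat.find_spec hhi
  have hxb : ∀ z, x ≤ z → z ≤ b → z ∈ D := by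
    intro z hz
    induction z, hz using Nat.le_induction with
    | base => exact fun _ => hx
    | succ z hz ih =>
      intro hzb
      by_contra hcon
      exact Nat.find_min hhi (show z < Nat.find hhi from hzb) ⟨hz, hcon⟩
  have hsub : Set.Icc a b ⊆ D := by
    intro z hz
    rcases le_total z x with h | h
    · exact haD ⟨hz.1, h⟩
    · exact hxb z h hz.2
  have hab : a + (b - a) = b := by omega
  refine ⟨Set.Icc a b, ⟨a, b - a, ?_, by rw [hab], hsub, ?_, ?_⟩, ⟨ha, hb⟩⟩
  · exact (hD (hsub ⟨le_rfl, by omega⟩)).1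
  · rcases Nat.eq_or_lt_of_le (hD (hsub ⟨le_rfl, by omega⟩ : a ∈ D)).1 with h | h
    · exact Or.inl h.symm
    · refine Or.inr fun hcon => Nat.find_min hlo (show a - 1 < Nat.find hlo by omega) ⟨by omega, ?_⟩
      intro z hz
      rcases Nat.eq_or_lt_of_le hz.1 with h' | h'
      · rwa [← h']
      · exact haD ⟨by change a ≤ z; omega, hz.2⟩
  · rw [hab]
    exact Or.inr hbD

theorem isBlock_reverse {n u v : ℕ} {D C : Set ℕ} (hD : D ⊆ Set.Icc 1 n) (hv : v ≤ n + 1)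
    (hu' : u ∉ D) (hv' : v ∉ D) (hC : IsBlock n D C) :
    IsBlock n {x | reverseBetween u v x ∈ D} {x | reverseBetween u v x ∈ C} := by
  obtain ⟨s, r, hs, rfl, hsub, hl, hr⟩ := hC
  have hune : ¬ (s ≤ u ∧ u ≤ s + r) := fun h => hu' (hsub h)
  have hvne : ¬ (s ≤ v ∧ v ≤ s + r) := fun h => hv' (hsub h)
  have hsn : s + r ≤ n := (hD (hsub ⟨by omega, le_rfl⟩)).2
  by_cases hin : u < s ∧ s < v
  · refine ⟨u + v - (s + r), r, by omega, ?_, fun x hx => hsub hx, Or.inr ?_, Or.inr ?_⟩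
    · ext x
      simp only [reverseBetween, Set.mem_ofPred_eq, Set.mem_Icc]
      split_ifs <;> omega
    · intro h
      simp only [reverseBetween, Set.mem_ofPred_eq] at h
      split_ifs at h with h'
      · rw [show u + v - (u + v - (s + r) - 1) = s + r + 1 by omega] at h
        have := (hD h).2
        rcases hr with hr | hr
        · omega
        · exact hr h
      · rw [show u + v - (s + r) - 1 = u by omega] at h
        exact hu' h
    · intro h
      simp only [reverseBetween, Set.mem_ofPred_eq] at h
      split_ifs at h with h'
      · rw [show u + v - (u + v - (s + r) + r + 1) = s - 1 by omega] at h
        have := (hD h).1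
        rcases hl with hl | hl
        · omega
        · exact hl h
      · rw [show u + v - (s + r) + r + 1 = v by omega] at h
        exact hv' h
  · have hlow : s = 1 ∨ reverseBetween u v (s - 1) ∉ D := by
      refine hl.imp_right fun hl => ?_
      have : reverseBetween u v (s - 1) = s - 1 := by
        unfold reverseBetween
        split_ifs <;> omega
      rwa [this]
    have hupp : s + r = n ∨ reverseBetween u v (s + r + 1) ∉ D := by
      refine hr.imp_right fun hr => ?_
      have : reverseBetween u v (s + r + 1) = s + r + 1 := by
        unfold reverseBetween
        split_ifs <;> omega
      rwa [this]
    refine ⟨s, r, hs, ?_, fun x hx => hsub hx, hlow, hupp⟩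
    ext x
    simp only [reverseBetween, Set.mem_ofPred_eq, Set.mem_Icc]
    split_ifs <;> omega

namespace BlockEnum

variable {n : ℕ} {D : Set ℕ} {p : ℕ} {A : ℕ → Set ℕ}

theorem exists_mem (h : BlockEnum n D p A) (hD : D ⊆ Set.Icc 1 n) {x : ℕ} (hx : x ∈ D) :
    ∃ j, 1 ≤ j ∧ j ≤ p ∧ x ∈ A j := by
  obtain ⟨C, hC, hxC⟩ := exists_isBlock_mem hD hx
  obtain ⟨j, h1, h2, rfl⟩ := h.cover C hC
  exact ⟨j, h1, h2, hxC⟩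

theorem subset (h : BlockEnum n D p A) {j : ℕ} (h1 : 1 ≤ j) (h2 : j ≤ p) : A j ⊆ D := by
  obtain ⟨s, r, -, -, hsub, -, -⟩ := h.isBlock j h1 h2
  exact hsub

theorem nonempty (h : BlockEnum n D p A) {j : ℕ} (h1 : 1 ≤ j) (h2 : j ≤ p) : (A j).Nonempty := by
  obtain ⟨s, r, -, hA, -, -, -⟩ := h.isBlock j h1 h2
  exact ⟨s, by rw [hA]; exact ⟨le_rfl, by omega⟩⟩

theorem index_unique (h : BlockEnum n D p A) {j j' x : ℕ} (h1 : 1 ≤ j) (h2 : j ≤ p)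
    (h1' : 1 ≤ j') (h2' : j' ≤ p) (hx : x ∈ A j) (hx' : x ∈ A j') : j = j' := by
  rcases lt_trichotomy j j' with hj | hj | hj
  · exact absurd (h.mono j j' h1 hj h2' x hx x hx') (lt_irrefl _)
  · exact hj
  · exact absurd (h.mono j' j h1' hj h2 x hx' x hx) (lt_irrefl _)

/-- Two consecutive elements of `D` lie in the same block. -/
theorem mem_of_adjacent (h : BlockEnum n D p A) (hD : D ⊆ Set.Icc 1 n) {j x y : ℕ} (h1 : 1 ≤ j)
    (h2 : j ≤ p) (hx : x ∈ A j) (hy : y ∈ D) (hxy : x + 1 = y ∨ y + 1 = x) : y ∈ A j := by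
  obtain ⟨s, r, hs, hA, -, hl, hr⟩ := h.isBlock j h1 h2
  have hy' := hD hy
  rw [hA] at hx ⊢
  simp only [Set.mem_Icc] at hx hy' ⊢
  rcases hxy with hxy | hxy
  · rcases hr with hr | hr
    · omega
    · have : y ≠ s + r + 1 := fun e => hr (e ▸ hy)
      omega
  · rcases hl with hl | hl
    · omega
    · have : y ≠ s - 1 := fun e => hl (e ▸ hy)
      omega

end BlockEnum

/-- The index permutation reversing `{m, …, k}`. -/
def reverseIndex (m k j : ℕ) : ℕ := if m ≤ j ∧ j ≤ k then m + k - j else j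

theorem BlockEnum.reverse {n p u v m k : ℕ} {D : Set ℕ} {A : ℕ → Set ℕ} (h : BlockEnum n D p A)
    (hD : D ⊆ Set.Icc 1 n) (hv : v ≤ n + 1) (hu' : u ∉ D) (hv' : v ∉ D)
    (hm : 1 ≤ m) (hk : k ≤ p)
    (hlow : ∀ j, 1 ≤ j → j < m → ∀ x ∈ A j, x < u)
    (hmid : ∀ j, m ≤ j → j ≤ k → ∀ x ∈ A j, u < x ∧ x < v)
    (hupp : ∀ j, k < j → j ≤ p → ∀ x ∈ A j, v < x) :
    BlockEnum n {x | reverseBetween u v x ∈ D} p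
      (fun j => {x | reverseBetween u v x ∈ A (reverseIndex m k j)}) where
  isBlock j h1 h2 := by
    refine isBlock_reverse hD hv hu' hv' (h.isBlock _ ?_ ?_) <;>
    · unfold reverseIndex
      split_ifs <;> omega
  mono j j' h1 hjj h2 a ha b hb := by
    have key : ∀ l z, 1 ≤ l → l ≤ p → reverseBetween u v z ∈ A (reverseIndex m k l) →
        (l < m ∧ z < u ∨ k < l ∧ v < z ∨
          m ≤ l ∧ l ≤ k ∧ u < z ∧ z < v ∧ u + v - z ∈ A (m + k - l)) ∧
        (¬ (m ≤ l ∧ l ≤ k) → z ∈ A l) := by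
      intro l z hl1 hl2 hz
      unfold reverseIndex at hz
      split_ifs at hz with hl
      · have := hmid _ (by omega) (by omega) _ hz
        unfold reverseBetween at this hz
        split_ifs at this hz with hz'
        · exact ⟨Or.inr (Or.inr ⟨hl.1, hl.2, hz'.1, hz'.2, hz⟩), fun hn => absurd hl hn⟩
        · exact absurd this hz'
      · rcases lt_or_ge l m with hlm | hlm
        · have := hlow l hl1 hlm _ hz
          unfold reverseBetween at this hz
          split_ifs at this hz with hz'
          · omega
          · exact ⟨Or.inl ⟨hlm, this⟩, fun _ => hz⟩
        · have := hupp l (by omega) hl2 _ hz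
          unfold reverseBetween at this hz
          split_ifs at this hz with hz'
          · omega
          · exact ⟨Or.inr (Or.inl ⟨by omega, this⟩), fun _ => hz⟩
    obtain ⟨ka, ka'⟩ := key j a h1 (by omega) ha
    obtain ⟨kb, kb'⟩ := key j' b (by omega) h2 hb
    by_cases hj : m ≤ j ∧ j ≤ k
    · by_cases hj' : m ≤ j' ∧ j' ≤ k
      · rcases ka with ka | ka | ⟨-, -, ka1, ka2, ka3⟩
        · omega
        · omega
        rcases kb with kb | kb | ⟨-, -, kb1, kb2, kb3⟩
        · omega
        · omega
        have := h.mono _ _ (by omega) (by omega) (by omega) _ kb3 _ ka3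
        omega
      · omega
    · by_cases hj' : m ≤ j' ∧ j' ≤ k
      · omega
      · exact h.mono j j' h1 hjj h2 a (ka' hj) b (kb' hj')
  cover C hC := by
    have hsub : {x | reverseBetween u v x ∈ D} ⊆ Set.Icc 1 n := by
      intro x hx
      have hx' := hD hx
      have : reverseBetween u v x ≠ u := fun e => hu' (e ▸ hx)
      simp only [Set.mem_Icc] at hx' ⊢
      unfold reverseBetween at hx'
      split_ifs at hx' <;> omega
    have huD : u ∉ {x | reverseBetween u v x ∈ D} := by
      simpa [reverseBetween] using hu'
    have hvD : v ∉ {x | reverseBetween u v x ∈ D} := by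
      simpa [reverseBetween] using hv'
    have hinv := reverseBetween_involutive u v
    have hC' := isBlock_reverse hsub hv huD hvD hC
    simp only [Set.mem_ofPred_eq, hinv _] at hC'
    obtain ⟨j, h1, h2, hj⟩ := h.cover _ hC'
    refine ⟨reverseIndex m k j, ?_, ?_, ?_⟩
    · unfold reverseIndex
      split_ifs <;> omega
    · unfold reverseIndex
      split_ifs <;> omega
    · have : reverseIndex m k (reverseIndex m k j) = j := by
        unfold reverseIndex
        split_ifs <;> omega
      rw [this, ← hj]
      ext x
      simp [hinv x]

namespace PartialInj

variable {n : ℕ} {α : PartialInj n}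

theorem dom_subset (α : PartialInj n) : α.dom ⊆ Set.Icc 1 n := by
  rintro x ⟨y, hy⟩
  obtain ⟨h1, h2, -, -⟩ := α.mem_le _ hy
  exact ⟨h1, h2⟩

theorem im_subset (α : PartialInj n) : α.im ⊆ Set.Icc 1 n := by
  rintro y ⟨x, hx⟩
  obtain ⟨-, -, h1, h2⟩ := α.mem_le _ hx
  exact ⟨h1, h2⟩

theorem FP.adjacent (h : α.FP) {x y x' y' : ℕ} (hx : (x, y) ∈ α.graph) (hx' : (x', y') ∈ α.graph)
    (hadj : x + 1 = x' ∨ x' + 1 = x) : y + 1 = y' ∨ y' + 1 = y := by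
  rcases Nat.even_or_odd x' with he | ho
  · exact (h _ hx _ hx' ⟨hadj, he⟩).1
  · have he : Even x := by
      rw [Nat.even_iff]
      rw [Nat.odd_iff] at ho
      omega
    exact (h _ hx' _ hx ⟨hadj.symm, he⟩).1.symm

theorem mem_reversal_mul {u v : ℕ} (hv : v ≤ n + 1) (hu' : u ∉ α.dom) (hv' : v ∉ α.dom) {x y : ℕ} :
    (x, y) ∈ (reversal n u v hv * α).graph ↔ (reverseBetween u v x, y) ∈ α.graph := by
  constructor
  · rintro ⟨z, h1, h2⟩
    obtain ⟨-, -, -, -, rfl⟩ := mem_reversal.1 h1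
    exact h2
  · intro h
    have hxu : x ≠ u := by
      rintro rfl
      exact hu' ⟨y, by simpa [reverseBetween] using h⟩
    have hxv : x ≠ v := by
      rintro rfl
      exact hv' ⟨y, by simpa [reverseBetween] using h⟩
    have hne : reverseBetween u v x ≠ u := fun e => hu' ⟨y, e ▸ h⟩
    have hr := α.dom_subset ⟨y, h⟩
    refine ⟨reverseBetween u v x, mem_reversal.2 ?_, h⟩
    simp only [Set.mem_Icc] at hr
    unfold reverseBetween at hr ⊢
    split_ifs at hr ⊢ <;> omega

theorem mem_mul_reversal {u v : ℕ} (hv : v ≤ n + 1) (hu' : u ∉ α.im) (hv' : v ∉ α.im) {x y : ℕ} :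
    (x, y) ∈ (α * reversal n u v hv).graph ↔ (x, reverseBetween u v y) ∈ α.graph := by
  have h := mem_reversal_mul (α := α.inv) hv hu' hv' (x := y) (y := x)
  rw [← reversal_inv, ← inv_mul] at h
  exact h

end PartialInj

theorem subset_reversal_im {n u v : ℕ} (hv : v ≤ n + 1) {D : Set ℕ} (hD : D ⊆ Set.Icc 1 n)
    (hu' : u ∉ D) (hv' : v ∉ D) : D ⊆ (reversal n u v hv).im := by
  intro x hx
  have hxn := hD hx
  simp only [Set.mem_Icc] at hxn
  have hxu : x ≠ u := fun e => hu' (e ▸ hx)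
  have hxv : x ≠ v := fun e => hv' (e ▸ hx)
  refine ⟨reverseBetween u v x, mem_reversal.2 ?_⟩
  rw [reverseBetween_involutive]
  unfold reverseBetween
  split_ifs <;> omega

theorem subset_reversal_dom {n u v : ℕ} (hv : v ≤ n + 1) {D : Set ℕ} (hD : D ⊆ Set.Icc 1 n)
    (hu' : u ∉ D) (hv' : v ∉ D) : D ⊆ (reversal n u v hv).dom := by
  rw [← reversal_inv]
  exact subset_reversal_im hv hD hu' hv'

theorem subset_dom_one {n : ℕ} {D : Set ℕ} (hD : D ⊆ Set.Icc 1 n) :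
    D ⊆ (1 : PartialInj n).dom :=
  fun x hx => ⟨x, hD hx, hD hx, rfl⟩

/-- The elements of `⟨J⟩` whose inverse lies in `⟨J⟩` too. -/
def IsInvGenerated {n : ℕ} (ω : PartialInj n) : Prop :=
  ω ∈ Subsemigroup.closure (Jset n) ∧ ω.inv ∈ Subsemigroup.closure (Jset n)

theorem IsInvGenerated.one (n : ℕ) : IsInvGenerated (1 : PartialInj n) := by
  have h := Subsemigroup.subset_closure (one_mem_Jset n)
  exact ⟨h, by rwa [inv_one]⟩

theorem IsInvGenerated.reversal {n u v : ℕ} (hv : v ≤ n + 1) (huv : u % 2 = v % 2) :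
    IsInvGenerated (reversal n u v hv) := by
  have h := Subsemigroup.subset_closure (reversal_mem_Jset hv huv)
  exact ⟨h, by rwa [reversal_inv]⟩

theorem IsInvGenerated.mul {n : ℕ} {ω ω' : PartialInj n} (hω : IsInvGenerated ω)
    (hω' : IsInvGenerated ω') : IsInvGenerated (ω * ω') := by
  refine ⟨mul_mem hω.1 hω'.1, ?_⟩
  rw [inv_mul]
  exact mul_mem hω'.2 hω.2

/-- A parity-preserving `α ∈ IF_n` with domain blocks `A 1 < ⋯ < A p` which is the identity on the
blocks before `A i`, and maps all later blocks beyond these. -/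
structure IdBefore {n : ℕ} (α : PartialInj n) (p i : ℕ) (A : ℕ → Set ℕ) : Prop where
  mem : α ∈ IFset n
  parity : ∀ q ∈ α.graph, q.2 % 2 = q.1 % 2
  blocks : BlockEnum n α.dom p A
  fixed : ∀ j, 1 ≤ j → j < i → ∀ x ∈ A j, (x, x) ∈ α.graph
  sep : ∀ j l, 1 ≤ j → j < i → i ≤ l → l ≤ p → ∀ a ∈ A j, ∀ b ∈ α.imageOf (A l), a < b

namespace IdBefore

variable {n : ℕ} {α : PartialInj n} {p i : ℕ} {A : ℕ → Set ℕ}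

theorem reversal_mul (h : IdBefore α p i A) {u v m k : ℕ} (hv : v ≤ n + 1) (huv : u % 2 = v % 2)
    (hi : 1 ≤ i) (him : i ≤ m) (hmk : m ≤ k) (hk : k ≤ p)
    (hlow : ∀ j, 1 ≤ j → j < m → ∀ x ∈ A j, x < u)
    (hmid : ∀ j, m ≤ j → j ≤ k → ∀ x ∈ A j, u < x ∧ x < v)
    (hupp : ∀ j, k < j → j ≤ p → ∀ x ∈ A j, v < x) :
    ∃ A' : ℕ → Set ℕ, IdBefore (reversal n u v hv * α) p i A' ∧
      (∀ j, A' j = {x | reverseBetween u v x ∈ A (reverseIndex m k j)}) ∧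
      (∀ j, 1 ≤ j → j < m → A' j = A j) ∧
      (∀ j, (reversal n u v hv * α).imageOf (A' j) = α.imageOf (A (reverseIndex m k j))) ∧
      α.dom ⊆ (reversal n u v hv).im := by
  have hD := α.dom_subset
  obtain ⟨y, hy⟩ := h.blocks.nonempty (show 1 ≤ m by omega) (show m ≤ p by omega)
  have huv' := hmid m le_rfl hmk y hy
  have hgap : u ∉ α.dom ∧ v ∉ α.dom := by
    constructor <;>
    · intro hx
      obtain ⟨j, h1, h2, hj⟩ := h.blocks.exists_mem hD hx
      rcases lt_or_ge j m with hjm | hjm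
      · have := hlow j h1 hjm _ hj
        omega
      · rcases le_or_gt j k with hjk | hjk
        · have := hmid j hjm hjk _ hj
          omega
        · have := hupp j hjk h2 _ hj
          omega
  obtain ⟨hu', hv'⟩ := hgap
  have hg : ∀ x y, (x, y) ∈ (reversal n u v hv * α).graph ↔ (reverseBetween u v x, y) ∈ α.graph :=
    fun x y => mem_reversal_mul hv hu' hv'
  have hdom : (reversal n u v hv * α).dom = {x | reverseBetween u v x ∈ α.dom} := by
    ext x
    simp only [dom, Set.mem_ofPred_eq, hg]
  have hagree : ∀ j, 1 ≤ j → j < m →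
      {x | reverseBetween u v x ∈ A (reverseIndex m k j)} = A j := by
    intro j h1 h2
    have : reverseIndex m k j = j := by
      unfold reverseIndex
      split_ifs <;> omega
    ext x
    rw [this]
    constructor
    · intro hx
      have := hlow j h1 h2 _ hx
      simp only [Set.mem_ofPred_eq] at hx
      unfold reverseBetween at this hx
      split_ifs at this hx
      · omega
      · exact hx
    · intro hx
      have := hlow j h1 h2 _ hx
      simp only [Set.mem_ofPred_eq]
      unfold reverseBetween
      rwa [if_neg (by omega)]
  have himage : ∀ j, (reversal n u v hv * α).imageOf
      {x | reverseBetween u v x ∈ A (reverseIndex m k j)} =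
        α.imageOf (A (reverseIndex m k j)) := by
    intro j
    ext y
    constructor
    · rintro ⟨x, hx, hxy⟩
      exact ⟨_, hx, (hg _ _).1 hxy⟩
    · rintro ⟨x, hx, hxy⟩
      refine ⟨reverseBetween u v x, ?_, (hg _ _).2 ?_⟩
      · simpa only [Set.mem_ofPred_eq, reverseBetween_involutive u v x] using hx
      · rwa [reverseBetween_involutive u v x]
  refine ⟨fun j => {x | reverseBetween u v x ∈ A (reverseIndex m k j)},
    ⟨mul_mem_IFset (reversal_mem_Jset hv huv).1 h.mem, ?_, ?_, ?_, ?_⟩,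
    fun j => rfl, hagree, himage, subset_reversal_im hv hD hu' hv'⟩
  · rintro ⟨x, y⟩ hq
    have := h.parity _ ((hg _ _).1 hq)
    simp only [reverseBetween] at this ⊢
    split_ifs at this <;> omega
  · rw [hdom]
    exact h.blocks.reverse hD hv hu' hv' (by omega) hk hlow hmid hupp
  · intro j h1 h2 x hx
    rw [hagree j h1 (by omega)] at hx
    have := hlow j h1 (by omega) x hx
    rw [hg]
    have : reverseBetween u v x = x := by
      unfold reverseBetween
      rw [if_neg (by omega)]
    rw [this]
    exact h.fixed j h1 h2 x hx
  · intro j l h1 h2 h3 h4 a ha b hb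
    rw [hagree j h1 (by omega)] at ha
    rw [himage] at hb
    refine h.sep j _ h1 h2 ?_ ?_ a ha b hb <;>
    · unfold reverseIndex
      split_ifs <;> omega

theorem mul_reversal (h : IdBefore α p i A) {u v : ℕ} (hv : v ≤ n + 1) (huv : u % 2 = v % 2)
    (hu' : u ∉ α.im) (hv' : v ∉ α.im)
    (hlow : ∀ j, 1 ≤ j → j < i → ∀ x ∈ A j, x < u)
    (hupp : ∀ l, i ≤ l → l ≤ p → ∀ y ∈ α.imageOf (A l), u < y) :
    IdBefore (α * reversal n u v hv) p i A := by
  have hg : ∀ x y, (x, y) ∈ (α * reversal n u v hv).graph ↔ (x, reverseBetween u v y) ∈ α.graph :=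
    fun x y => mem_mul_reversal hv hu' hv'
  have hdom : (α * reversal n u v hv).dom = α.dom := by
    ext x
    constructor
    · rintro ⟨y, hy⟩
      exact ⟨_, (hg _ _).1 hy⟩
    · rintro ⟨y, hy⟩
      refine ⟨reverseBetween u v y, (hg _ _).2 ?_⟩
      rwa [reverseBetween_involutive u v y]
  refine ⟨mul_mem_IFset h.mem (reversal_mem_Jset hv huv).1, ?_, ?_, ?_, ?_⟩
  · rintro ⟨x, y⟩ hq
    have := h.parity _ ((hg _ _).1 hq)
    simp only [reverseBetween] at this ⊢
    split_ifs at this <;> omega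
  · rw [hdom]
    exact h.blocks
  · intro j h1 h2 x hx
    have := hlow j h1 h2 x hx
    rw [hg]
    have : reverseBetween u v x = x := by
      unfold reverseBetween
      rw [if_neg (by omega)]
    rw [this]
    exact h.fixed j h1 h2 x hx
  · rintro j l h1 h2 h3 h4 a ha b ⟨x, hx, hxb⟩
    have ha' := hlow j h1 h2 a ha
    have hb := hupp l h3 h4 _ ⟨x, hx, (hg _ _).1 hxb⟩
    unfold reverseBetween at hb
    split_ifs at hb <;> omega

/-- The image of a block lies on one side of every image point of another block. -/
theorem image_lt_of_image_lt (h : IdBefore α p i A) {j l y y₂ z : ℕ} (hj : 1 ≤ j) (hj' : j ≤ p)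
    (hl : 1 ≤ l) (hl' : l ≤ p) (hjl : j ≠ l) (hy : y ∈ α.imageOf (A j))
    (hy₂ : y₂ ∈ α.imageOf (A j)) (hz : z ∈ α.imageOf (A l)) (hyz : y < z) : y₂ < z := by
  obtain ⟨w, hw, hwz⟩ := hz
  have hne : ∀ x ∈ A j, (x, z) ∉ α.graph := by
    intro x hx hxz
    have : x = w := α.injOn _ hxz _ hwz rfl
    subst this
    exact hjl (h.blocks.index_unique hj hj' hl hl' hx hw)
  obtain ⟨s, r, hs, hA, hsub, -, -⟩ := h.blocks.isBlock j hj hj'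
  obtain ⟨w₀, hw₀⟩ := hsub (show s ∈ A j by rw [hA]; exact ⟨le_rfl, by omega⟩)
  have key : ∀ t, t ≤ r → ∀ w, (s + t, w) ∈ α.graph → (w < z ↔ w₀ < z) := by
    intro t
    induction t with
    | zero =>
      intro _ w hw
      rw [show w = w₀ from α.functional _ hw _ hw₀ rfl]
    | succ t ih =>
      intro ht w hw
      have hmem : s + t ∈ A j := by rw [hA]; exact ⟨by omega, by omega⟩
      have hmem' : s + (t + 1) ∈ A j := by rw [hA]; exact ⟨by omega, by omega⟩
      obtain ⟨w', hw'⟩ := hsub hmem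
      rw [← ih (by omega) w' hw']
      have h1 := h.mem.1.adjacent hw' hw (Or.inl rfl)
      have h2 : w ≠ z := fun e => hne _ hmem' (e ▸ hw)
      have h3 : w' ≠ z := fun e => hne _ hmem (e ▸ hw')
      omega
  have key' : ∀ y ∈ α.imageOf (A j), (y < z ↔ w₀ < z) := by
    rintro y ⟨x, hx, hxy⟩
    rw [hA] at hx
    refine key (x - s) (by have := hx.2; omega) y ?_
    rwa [show s + (x - s) = x by have := hx.1; omega]
  rw [key' _ hy₂, ← key' _ hy]
  exact hyz

/-- An image point adjacent to an image point of a block belongs to the image of that block. -/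
theorem mem_imageOf_of_adjacent (h : IdBefore α p i A) {j y z : ℕ} (hj : 1 ≤ j) (hj' : j ≤ p)
    (hy : y ∈ α.imageOf (A j)) (hz : z ∈ α.im) (hyz : y + 1 = z ∨ z + 1 = y) :
    z ∈ α.imageOf (A j) := by
  obtain ⟨x, hx, hxy⟩ := hy
  obtain ⟨w, hw⟩ := hz
  have := FP.adjacent h.mem.2 (show (y, x) ∈ α.inv.graph from hxy)
    (show (z, w) ∈ α.inv.graph from hw) hyz
  exact ⟨w, h.blocks.mem_of_adjacent α.dom_subset hj hj' hx ⟨z, hw⟩ this, hw⟩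

/-- If `y` is the largest or the smallest image point of the block `[s, t]`, then it is the image
of an endpoint. -/
theorem eq_or_eq_of_extremal (h : IdBefore α p i A) {j s t x y : ℕ} (hj : 1 ≤ j) (hj' : j ≤ p)
    (hA : A j = Set.Icc s t) (hx : x ∈ A j) (hxy : (x, y) ∈ α.graph)
    (hext : (∀ z ∈ α.imageOf (A j), y ≤ z) ∨ (∀ z ∈ α.imageOf (A j), z ≤ y)) :
    x = s ∨ x = t := by
  by_contra hcon
  have hx' := hx
  rw [hA, Set.mem_Icc] at hx'
  have hm1 : x - 1 ∈ A j := by rw [hA]; exact ⟨by omega, by omega⟩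
  have hm2 : x + 1 ∈ A j := by rw [hA]; exact ⟨by omega, by omega⟩
  obtain ⟨y1, hy1⟩ := h.blocks.subset hj hj' hm1
  obtain ⟨y2, hy2⟩ := h.blocks.subset hj hj' hm2
  have a1 := h.mem.1.adjacent hxy hy1 (Or.inr (by omega))
  have a2 := h.mem.1.adjacent hxy hy2 (Or.inl rfl)
  have hne : y1 ≠ y2 := by
    rintro rfl
    have : x - 1 = x + 1 := α.injOn _ hy1 _ hy2 rfl
    omega
  rcases hext with hext | hext
  · have b1 := hext y1 ⟨_, hm1, hy1⟩
    have b2 := hext y2 ⟨_, hm2, hy2⟩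
    omega
  · have b1 := hext y1 ⟨_, hm1, hy1⟩
    have b2 := hext y2 ⟨_, hm2, hy2⟩
    omega

theorem not_isBlock_between (h : IdBefore α p i A) (hi : 1 < i) (hip : i ≤ p)
    (hlt : ∀ l, i < l → l ≤ p → ∀ b ∈ α.imageOf (A i), ∀ c ∈ α.imageOf (A l), b < c)
    {C : Set ℕ} (hC : IsBlock n α.im C) :
    ¬((∀ a ∈ A (i - 1), ∀ c ∈ C, a < c) ∧ (∀ c ∈ C, ∀ b ∈ α.imageOf (A i), c < b)) := by
  rintro ⟨hlo, hhi⟩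
  obtain ⟨s, r, -, rfl, hsub, -, -⟩ := hC
  have hs : s ∈ Set.Icc s (s + r) := ⟨le_rfl, by omega⟩
  obtain ⟨x, hx⟩ := hsub hs
  obtain ⟨l, h1, h2, hl⟩ := h.blocks.exists_mem α.dom_subset ⟨s, hx⟩
  have hmem : s ∈ α.imageOf (A l) := ⟨x, hl, hx⟩
  rcases lt_trichotomy l i with hli | rfl | hli
  · have : x = s := α.functional _ (h.fixed l h1 hli x hl) _ hx rfl
    subst this
    by_cases he : l = i - 1
    · subst he
      exact lt_irrefl _ (hlo x hl x hs)
    · obtain ⟨a, ha⟩ := h.blocks.nonempty (j := i - 1) (by omega) (by omega)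
      have := h.blocks.mono l (i - 1) h1 (by omega) (by omega) x hl a ha
      have := hlo a ha x hs
      omega
  · exact lt_irrefl _ (hhi s hs s hmem)
  · obtain ⟨a, ha⟩ := h.blocks.nonempty (j := i) (by omega) hip
    obtain ⟨b, hb⟩ := h.blocks.subset (by omega) hip ha
    have hb' : b ∈ α.imageOf (A i) := ⟨a, ha, hb⟩
    have := hlt l hli h2 b hb' s hmem
    have := hhi s hs b hb'
    omega

/-- The block whose image contains the least image point of the blocks `A i, …, A p` is mapped
before all other ones among these. -/
theorem image_lt_of_least (h : IdBefore α p i A) (hi : 1 ≤ i) {k c : ℕ} (hik : i ≤ k) (hkp : k ≤ p)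
    (hc : c ∈ α.imageOf (A k)) (hmin : ∀ l, i ≤ l → l ≤ p → ∀ y ∈ α.imageOf (A l), c ≤ y)
    {l : ℕ} (hil : i ≤ l) (hlp : l ≤ p) (hlk : l ≠ k) :
    ∀ b ∈ α.imageOf (A k), ∀ y ∈ α.imageOf (A l), b < y := by
  intro b hb y hy
  refine h.image_lt_of_image_lt (by omega) hkp (by omega) hlp hlk.symm hc hb hy ?_
  refine lt_of_le_of_ne (hmin l hil hlp y hy) ?_
  rintro rfl
  obtain ⟨x, hx, hxc⟩ := hc
  obtain ⟨w, hw, hwc⟩ := hy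
  have : x = w := α.injOn _ hxc _ hwc rfl
  subst this
  exact hlk (h.blocks.index_unique (by omega) hlp (by omega) hkp hw hx)

/-- The least image point of the blocks `A i, …, A p`. -/
theorem exists_least_image (h : IdBefore α p i A) (hi : 1 ≤ i) (hip : i ≤ p) :
    ∃ k c, i ≤ k ∧ k ≤ p ∧ c ∈ α.imageOf (A k) ∧
      ∀ l, i ≤ l → l ≤ p → ∀ y ∈ α.imageOf (A l), c ≤ y := by
  classical
  have hex : ∃ c k, i ≤ k ∧ k ≤ p ∧ c ∈ α.imageOf (A k) := by
    obtain ⟨a, ha⟩ := h.blocks.nonempty hi hip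
    obtain ⟨b, hb⟩ := h.blocks.subset hi hip ha
    exact ⟨b, i, le_rfl, hip, a, ha, hb⟩
  obtain ⟨k, h1, h2, h3⟩ := Nat.find_spec hex
  exact ⟨k, Nat.find hex, h1, h2, h3, fun l hl hl' y hy => Nat.find_min' hex ⟨l, hl, hl', hy⟩⟩

/-- One reversal of the domain brings the block `A k` to position `i`. -/
theorem exists_reversal_left (h : IdBefore α p i A) (hi : 1 ≤ i) {k u v : ℕ} (hik : i ≤ k)
    (hkp : k ≤ p) (hv : v ≤ n + 1) (huv : u % 2 = v % 2)
    (hlow : ∀ j, 1 ≤ j → j < i → ∀ x ∈ A j, x < u)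
    (hmid : ∀ j, i ≤ j → j ≤ k → ∀ x ∈ A j, u < x ∧ x < v)
    (hupp : ∀ j, k < j → j ≤ p → ∀ x ∈ A j, v < x)
    (hlt : ∀ l, i ≤ l → l ≤ p → l ≠ k → ∀ b ∈ α.imageOf (A k), ∀ y ∈ α.imageOf (A l), b < y) :
    ∃ (ω : PartialInj n) (A' : ℕ → Set ℕ), IsInvGenerated ω ∧ α.dom ⊆ ω.im ∧
      IdBefore (ω * α) p i A' ∧ (∀ j, 1 ≤ j → j < i → A' j = A j) ∧
      ∀ l, i < l → l ≤ p → ∀ b ∈ (ω * α).imageOf (A' i), ∀ y ∈ (ω * α).imageOf (A' l), b < y := by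
  obtain ⟨A', hA', -, hagree, himage, hdom⟩ :=
    h.reversal_mul hv huv hi le_rfl hik hkp hlow hmid hupp
  refine ⟨_, A', IsInvGenerated.reversal hv huv, hdom, hA', hagree, ?_⟩
  intro l hl hlp
  rw [himage, himage, show reverseIndex i k i = k by unfold reverseIndex; split_ifs <;> omega]
  refine hlt _ ?_ ?_ ?_ <;>
  · unfold reverseIndex
    split_ifs <;> omega

/-- One reversal of the image brings the image of `A i` before those of `A (i + 1), …, A p`. -/
theorem exists_reversal_right (h : IdBefore α p i A) (hi : 1 ≤ i) (hip : i ≤ p) {u t : ℕ}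
    (huv : u % 2 = (t + 1) % 2) (hu' : u ∉ α.im)
    (hlow : ∀ j, 1 ≤ j → j < i → ∀ x ∈ A j, x < u)
    (hupp : ∀ l, i ≤ l → l ≤ p → ∀ y ∈ α.imageOf (A l), u < y)
    (ht : t ∈ α.imageOf (A i)) (hmax : ∀ y ∈ α.imageOf (A i), y ≤ t) :
    ∃ ω : PartialInj n, IsInvGenerated ω ∧ α.im ⊆ ω.dom ∧ IdBefore (α * ω) p i A ∧
      ∀ l, i < l → l ≤ p → ∀ b ∈ (α * ω).imageOf (A i), ∀ y ∈ (α * ω).imageOf (A l), b < y := by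
  have htim : t ∈ α.im := by
    obtain ⟨x, -, hx⟩ := ht
    exact ⟨x, hx⟩
  have hv : t + 1 ≤ n + 1 := by
    have := (α.im_subset htim).2
    omega
  have hv' : t + 1 ∉ α.im := by
    intro hcon
    have := hmax _ (h.mem_imageOf_of_adjacent hi hip ht hcon (Or.inl rfl))
    omega
  refine ⟨_, IsInvGenerated.reversal hv huv, subset_reversal_dom hv α.im_subset hu' hv',
    h.mul_reversal hv huv hu' hv' hlow hupp, ?_⟩
  rintro l hl hlp b ⟨x, hx, hxb⟩ y ⟨w, hw, hwy⟩
  rw [mem_mul_reversal hv hu' hv'] at hxb hwy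
  have hb' : reverseBetween u (t + 1) b ∈ α.imageOf (A i) := ⟨x, hx, hxb⟩
  have hy' : reverseBetween u (t + 1) y ∈ α.imageOf (A l) := ⟨w, hw, hwy⟩
  have h1 := hupp i le_rfl hip _ hb'
  have h2 := hmax _ hb'
  have h3 := hupp l hl.le hlp _ hy'
  have h5 : reverseBetween u (t + 1) y ≠ t + 1 := by
    intro e
    rw [e] at hwy
    exact hv' ⟨w, hwy⟩
  have h6 : reverseBetween u (t + 1) y ≤ t →
      reverseBetween u (t + 1) y < reverseBetween u (t + 1) b := by
    intro hle
    refine h.image_lt_of_image_lt (by omega) hlp hi hip hl.ne' hy' hy' hb' ?_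
    by_contra hcon
    have hne : reverseBetween u (t + 1) y ≠ t := by
      intro e
      obtain ⟨w', hw', hwt⟩ := ht
      rw [e] at hwy
      have : w = w' := α.injOn _ hwy _ hwt rfl
      subst this
      exact hl.ne (h.blocks.index_unique hi hip (by omega) hlp hw' hw)
    have hlt : reverseBetween u (t + 1) b < reverseBetween u (t + 1) y ∨
        reverseBetween u (t + 1) b = reverseBetween u (t + 1) y := by omega
    rcases hlt with hlt | heq
    · have := h.image_lt_of_image_lt hi hip (by omega) hlp hl.ne hb' ht hy' hlt
      omega
    · have : x = w := α.injOn _ hxb _ hwy heq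
      subst this
      exact hl.ne (h.blocks.index_unique hi hip (by omega) hlp hx hw)
  unfold reverseBetween at h1 h2 h3 h5 h6
  split_ifs at h1 h2 h3 h5 h6 <;> omega

/-- Changing the domain only, or the image only, suffices to make the image of the `i`-th block
come before those of the later blocks. -/
theorem exists_left_or_right (h : IdBefore α p i A) (hi : 1 ≤ i) (hip : i ≤ p) :
    (∃ (ω : PartialInj n) (A' : ℕ → Set ℕ), IsInvGenerated ω ∧ α.dom ⊆ ω.im ∧
      IdBefore (ω * α) p i A' ∧ (∀ j, 1 ≤ j → j < i → A' j = A j) ∧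
      ∀ l, i < l → l ≤ p → ∀ b ∈ (ω * α).imageOf (A' i), ∀ y ∈ (ω * α).imageOf (A' l), b < y) ∨
    (∃ ω : PartialInj n, IsInvGenerated ω ∧ α.im ⊆ ω.dom ∧ IdBefore (α * ω) p i A ∧
      ∀ l, i < l → l ≤ p → ∀ b ∈ (α * ω).imageOf (A i), ∀ y ∈ (α * ω).imageOf (A l), b < y) := by
  obtain ⟨k, c, hik, hkp, hc, hmin⟩ := h.exists_least_image hi hip
  have hlt : ∀ l, i ≤ l → l ≤ p → l ≠ k → ∀ b ∈ α.imageOf (A k), ∀ y ∈ α.imageOf (A l), b < y :=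
    fun l hil hlp hlk => h.image_lt_of_least hi hik hkp hc hmin hil hlp hlk
  rcases Nat.eq_or_lt_of_le hik with rfl | hik'
  · refine Or.inr ⟨1, IsInvGenerated.one n, subset_dom_one α.im_subset, ?_, ?_⟩
    · rwa [mul_one]
    · rw [mul_one]
      exact fun l hl hlp => hlt l hl.le hlp hl.ne'
  obtain ⟨e, r, he, hAi, hsubi, hel, her⟩ := h.blocks.isBlock i hi hip
  obtain ⟨a, r', ha, hAk, hsubk, hal, har⟩ := h.blocks.isBlock k (by omega) hkp
  have hmem_i : ∀ x, x ∈ A i ↔ e ≤ x ∧ x ≤ e + r := fun x => by rw [hAi, Set.mem_Icc]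
  have hmem_k : ∀ x, x ∈ A k ↔ a ≤ x ∧ x ≤ a + r' := fun x => by rw [hAk, Set.mem_Icc]
  have heA : e ∈ A i := (hmem_i e).2 ⟨le_rfl, by omega⟩
  have hfA : e + r ∈ A i := (hmem_i _).2 ⟨by omega, le_rfl⟩
  have haA : a ∈ A k := (hmem_k a).2 ⟨le_rfl, by omega⟩
  have hbA : a + r' ∈ A k := (hmem_k _).2 ⟨by omega, le_rfl⟩
  have hbn : a + r' ≤ n := (α.dom_subset (hsubk hbA)).2
  have hmono := h.blocks.mono
  have hbelow : ∀ j, 1 ≤ j → j < i → ∀ x ∈ A j, x + 1 < e := by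
    intro j h1 h2 x hx
    have h3 := hmono j i h1 h2 hip x hx e heA
    have h4 : x + 1 ≠ e := by
      intro hxe
      exact h2.ne (h.blocks.index_unique h1 (by omega) hi hip (h.blocks.mem_of_adjacent
        α.dom_subset h1 (by omega) hx (hsubi heA) (Or.inl hxe)) heA)
    omega
  have hfa : e + r + 1 < a := by
    have h3 := hmono i k hi hik' hkp _ hfA a haA
    have h4 : e + r + 1 ≠ a := by
      intro hxe
      exact hik'.ne (h.blocks.index_unique hi hip (by omega) hkp (h.blocks.mem_of_adjacent
        α.dom_subset hi hip hfA (hsubk haA) (Or.inl hxe)) haA)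
    omega
  have hmid : ∀ j, i ≤ j → j ≤ k → ∀ x ∈ A j, e ≤ x ∧ x ≤ a + r' := by
    intro j h1 h2 x hx
    constructor
    · rcases Nat.eq_or_lt_of_le h1 with rfl | h1
      · exact ((hmem_i x).1 hx).1
      · exact (hmono i j hi h1 (by omega) e heA x hx).le
    · rcases Nat.eq_or_lt_of_le h2 with rfl | h2
      · exact ((hmem_k x).1 hx).2
      · exact (hmono j k (by omega) h2 hkp x hx _ hbA).le
  have habove : ∀ j, k < j → j ≤ p → ∀ x ∈ A j, a + r' + 1 < x := by
    intro j h1 h2 x hx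
    have h3 := hmono k j (by omega) h1 h2 _ hbA x hx
    have h4 : a + r' + 1 ≠ x := by
      intro hxe
      exact h1.ne (h.blocks.index_unique (by omega) hkp (by omega) h2 (h.blocks.mem_of_adjacent
        α.dom_subset (by omega) hkp hbA (h.blocks.subset (by omega) h2 hx) (Or.inl hxe)) hx)
    omega
  by_cases hpar1 : (a + r') % 2 = e % 2
  · refine Or.inl (h.exists_reversal_left hi hik hkp (u := e - 1) (v := a + r' + 1)
      (by omega) (by omega) ?_ ?_ habove hlt)
    · intro j h1 h2 x hx
      have := hbelow j h1 h2 x hx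
      omega
    · intro j h1 h2 x hx
      have := hmid j h1 h2 x hx
      omega
  by_cases hgap : 2 ≤ e ∧ e - 2 ∉ α.dom
  · -- there are two gap points before `A i`
    refine Or.inl (h.exists_reversal_left hi hik hkp (u := e - 2) (v := a + r' + 1)
      (by omega) (by omega) ?_ ?_ habove hlt)
    · intro j h1 h2 x hx
      have := hbelow j h1 h2 x hx
      have : x ≠ e - 2 := by
        rintro rfl
        exact hgap.2 (h.blocks.subset h1 (by omega) hx)
      omega
    · intro j h1 h2 x hx
      have := hmid j h1 h2 x hx
      omega
  have him_lt : ∀ y ∈ α.im, y < c → ∃ j, 1 ≤ j ∧ j < i ∧ y ∈ A j := by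
    rintro y ⟨x, hx⟩ hyc
    obtain ⟨j, h1, h2, hj⟩ := h.blocks.exists_mem α.dom_subset ⟨y, hx⟩
    have hji : j < i := by
      by_contra hcon
      have := hmin j (by omega) h2 y ⟨x, hj, hx⟩
      omega
    have : x = y := α.functional _ (h.fixed j h1 hji x hj) _ hx rfl
    exact ⟨j, h1, hji, this ▸ hj⟩
  have hlow_c : ∀ j, 1 ≤ j → j < i → ∀ x ∈ A j, x + 1 < c := by
    intro j h1 h2 x hx
    have h3 := h.sep j k h1 h2 hik hkp x hx c hc
    have h4 : x + 1 ≠ c := by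
      intro hxc
      have hxim : c ∈ α.im := hc.imp fun _ => And.right
      obtain ⟨w, hw, hwc⟩ := h.mem_imageOf_of_adjacent h1 (by omega)
        ⟨x, hx, h.fixed j h1 h2 x hx⟩ hxim (Or.inl hxc)
      obtain ⟨w', hw', hwc'⟩ := hc
      have : w = w' := α.injOn _ hwc _ hwc' rfl
      subst this
      have := h.blocks.index_unique h1 (by omega) (by omega) hkp hw hw'
      omega
    omega
  have hc1 : 1 ≤ c := by
    obtain ⟨x, -, hx⟩ := hc
    exact (α.mem_le _ hx).2.2.1
  -- the largest image point of `A i`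
  obtain ⟨t, ht, hmax⟩ : ∃ t ∈ α.imageOf (A i), ∀ y ∈ α.imageOf (A i), y ≤ t := by
    have hfin : (α.imageOf (A i)).Finite :=
      (Set.finite_Icc 1 n).subset fun y ⟨x, _, hx⟩ => α.im_subset ⟨x, hx⟩
    have hne : (α.imageOf (A i)).Nonempty := by
      obtain ⟨y, hy⟩ := hsubi heA
      exact ⟨y, e, heA, hy⟩
    obtain ⟨t, ht⟩ := hfin.exists_maximal hne
    exact ⟨t, ht.1, fun y hy => (le_total y t).elim id (fun hty => ht.2 hy hty)⟩
  by_cases hpar2 : c % 2 = t % 2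
  · -- the interval from the first image block to the image of `A i` has odd length
    refine Or.inr (h.exists_reversal_right hi hip (u := c - 1) (t := t) (by omega) ?_ ?_ ?_
      ht hmax)
    · intro hcon
      obtain ⟨j, h1, h2, hj⟩ := him_lt _ hcon (by omega)
      have := hlow_c j h1 h2 _ hj
      omega
    · intro j h1 h2 x hx
      have := hlow_c j h1 h2 x hx
      omega
    · intro l h1 h2 y hy
      have := hmin l h1 h2 y hy
      omega
  by_cases hce : c = e
  · -- `A i` and `A k` have even length and are translated: two reversals of the domain
    obtain ⟨x, hx, hxc⟩ := hc
    have hxend := h.eq_or_eq_of_extremal (by omega) hkp hAk hx hxc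
      (Or.inl fun z hz => hmin k hik hkp z hz)
    obtain ⟨w, hw, hwt⟩ := ht
    have hwend := h.eq_or_eq_of_extremal hi hip hAi hw hwt (Or.inr hmax)
    have hp1 := h.parity _ hxc
    have hp2 := h.parity _ hwt
    simp only at hp1 hp2
    have hpa : a % 2 = e % 2 := by
      rcases hxend with rfl | rfl <;> omega
    have hpf : (e + r) % 2 ≠ e % 2 := by
      rcases hwend with rfl | rfl <;> omega
    have hv₁ : a + r' + 1 ≤ n + 1 := by omega
    obtain ⟨A', hA', hA'def, hagree, himage, hdom⟩ :=
      h.reversal_mul (u := e + r + 1) (v := a + r' + 1) (m := i + 1) (k := k) hv₁ (by omega) hi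
        (by omega) (by omega) hkp
        (by
          intro j h1 h2 x hx
          rcases Nat.eq_or_lt_of_le (Nat.lt_succ_iff.1 h2) with rfl | h2
          · have := ((hmem_i x).1 hx).2
            omega
          · have := hbelow j h1 h2 x hx
            omega)
        (by
          intro j h1 h2 x hx
          have h3 := hmid j (by omega) h2 x hx
          have h4 := hmono i j hi (by omega) (by omega) _ hfA x hx
          have h5 : e + r + 1 ≠ x := by
            intro hxe
            have := h.blocks.index_unique hi hip (by omega) (by omega) (h.blocks.mem_of_adjacent
              α.dom_subset hi hip hfA (h.blocks.subset (by omega) (by omega) hx) (Or.inl hxe)) hx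
            omega
          omega)
        habove
    have hA'i : A' i = A i := hagree i hi (by omega)
    have hi1 : reverseIndex (i + 1) k (i + 1) = k := by
      unfold reverseIndex
      split_ifs <;> omega
    have hA'k : ∀ x ∈ A' (i + 1), e + r + 2 ≤ x ∧ x ≤ e + r + 2 + r' := by
      intro x hx
      rw [hA'def, hi1] at hx
      have := (hmem_k _).1 hx
      unfold reverseBetween at this
      split_ifs at this <;> omega
    obtain ⟨ω, A'', h1, h2, h3, h4, h5⟩ := hA'.exists_reversal_left hi (k := i + 1) (u := e - 1)
      (v := e + r + 3 + r') (by omega) (by omega) (by omega) (by omega)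
      (by
        intro j h1 h2 x hx
        rw [hagree j h1 (by omega)] at hx
        have := hbelow j h1 h2 x hx
        omega)
      (by
        intro j h1 h2 x hx
        rcases Nat.eq_or_lt_of_le h1 with rfl | h1
        · rw [hA'i, hmem_i] at hx
          omega
        · obtain rfl : j = i + 1 := by omega
          have := hA'k x hx
          omega)
      (by
        intro j h1 h2 x hx
        rw [hA'def] at hx
        have hidx : reverseIndex (i + 1) k j = if j ≤ k then i + 1 + k - j else j := by
          unfold reverseIndex
          split_ifs <;> omega
        rw [hidx] at hx
        split_ifs at hx with hjk
        · have h6 := hmono _ k (by omega) (by omega) hkp _ hx a haA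
          have h7 := hmono i _ hi (by omega) (by omega) _ hfA _ hx
          have h8 : reverseBetween (e + r + 1) (a + r' + 1) x + 1 ≠ a := by
            intro hxe
            have := h.blocks.index_unique (by omega) (by omega) (by omega) hkp
              (h.blocks.mem_of_adjacent α.dom_subset (by omega) (by omega) hx (hsubk haA)
                (Or.inl hxe)) haA
            omega
          have h9 : reverseBetween (e + r + 1) (a + r' + 1) x ≠ e + r + 1 := by
            intro hxe
            have := h.blocks.index_unique hi hip (by omega) (by omega)
              (h.blocks.mem_of_adjacent α.dom_subset hi hip hfA
                (h.blocks.subset (by omega) (by omega) hx) (Or.inl hxe.symm)) hx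
            omega
          unfold reverseBetween at h6 h7 h8 h9
          split_ifs at h6 h7 h8 h9 <;> omega
        · have h6 := habove _ (by omega) h2 _ hx
          unfold reverseBetween at h6
          split_ifs at h6 <;> omega)
      (by
        intro l h1 h2 h3
        rw [himage, himage, hi1]
        refine hlt _ ?_ ?_ ?_ <;>
        · unfold reverseIndex
          split_ifs <;> omega)
    refine Or.inl ⟨ω * reversal n (e + r + 1) (a + r' + 1) hv₁, A'',
      h1.mul (IsInvGenerated.reversal hv₁ (by omega)), ?_, ?_, ?_, ?_⟩
    · intro z hz
      obtain ⟨z', hz'⟩ := hdom hz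
      obtain ⟨y, hy⟩ := hz
      obtain ⟨z'', hz''⟩ := h2 (show z' ∈ _ from ⟨y, z, hz', hy⟩)
      exact ⟨z'', z', hz'', hz'⟩
    · rwa [mul_assoc]
    · intro j h6 h7
      rw [h4 j h6 h7, hagree j h6 (by omega)]
    · rwa [mul_assoc]
  · -- there are two gap points before the first image block
    have hc2 : e + 1 ≤ c := by
      by_cases he2 : 2 ≤ e
      · have hmem : e - 2 ∈ α.dom := by
          by_contra hcon
          exact hgap ⟨he2, hcon⟩
        obtain ⟨j, h1, h2, hj⟩ := h.blocks.exists_mem α.dom_subset hmem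
        have hji : j < i := by
          by_contra hcon
          rcases Nat.eq_or_lt_of_le (not_lt.1 hcon) with rfl | hji
          · have := (hmem_i _).1 hj
            omega
          · have := hmono i j hi hji h2 e heA _ hj
            omega
        have := hlow_c j h1 hji _ hj
        omega
      · omega
    refine Or.inr (h.exists_reversal_right hi hip (u := c - 2) (t := t) (by omega) ?_ ?_ ?_
      ht hmax)
    · intro hcon
      obtain ⟨j, h1, h2, hj⟩ := him_lt _ hcon (by omega)
      have := hbelow j h1 h2 _ hj
      omega
    · intro j h1 h2 x hx
      have := hbelow j h1 h2 x hx
      omega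
    · intro l h1 h2 y hy
      have := hmin l h1 h2 y hy
      omega

theorem exists_image_first (h : IdBefore α p i A) (hi : 1 ≤ i) (hip : i ≤ p) :
    ∃ (ω₁ ω₂ : PartialInj n) (A' : ℕ → Set ℕ), IsInvGenerated ω₁ ∧ IsInvGenerated ω₂ ∧
      α.dom ⊆ ω₁.im ∧ α.im ⊆ ω₂.dom ∧ IdBefore (ω₁ * α * ω₂) p i A' ∧
      (∀ j, 1 ≤ j → j < i → A' j = A j) ∧
      ∀ l, i < l → l ≤ p → ∀ b ∈ (ω₁ * α * ω₂).imageOf (A' i),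
        ∀ c ∈ (ω₁ * α * ω₂).imageOf (A' l), b < c := by
  rcases h.exists_left_or_right hi hip with ⟨ω, A', h1, h2, h3, h4, h5⟩ | ⟨ω, h1, h2, h3, h4⟩
  · exact ⟨ω, 1, A', h1, IsInvGenerated.one n, h2, subset_dom_one α.im_subset, by rwa [mul_one], h4,
      by rwa [mul_one]⟩
  · refine ⟨1, ω, A, IsInvGenerated.one n, h1, ?_, h2, by rwa [one_mul], fun _ _ _ => rfl,
      by rwa [one_mul]⟩
    rw [← inv_one]
    exact subset_dom_one α.dom_subset

end IdBefore

/-- Proposition 2. -/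
theorem prop2 (n : ℕ) (α : PartialInj n) (hα : α ∈ IFset n)
    (hpar : ∀ q ∈ α.graph, q.2 % 2 = q.1 % 2)
    (p : ℕ) (hp : 1 ≤ p) (A : ℕ → Set ℕ)
    (hblocks : ∀ j, 1 ≤ j → j ≤ p → IsBlock n α.dom (A j))
    (hmono : ∀ j j', 1 ≤ j → j < j' → j' ≤ p → ∀ a ∈ A j, ∀ b ∈ A j', a < b)
    (hcover : ∀ C, IsBlock n α.dom C → ∃ j, 1 ≤ j ∧ j ≤ p ∧ C = A j)
    (i : ℕ) (hi1 : 1 ≤ i) (hip : i ≤ p)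
    (hcase : i = 1 ∨
      ((∀ j, 1 ≤ j → j < i → ∀ x ∈ A j, (x, x) ∈ α.graph) ∧
        (∀ l, i ≤ l → l ≤ p → ∀ a ∈ A (i - 1), ∀ b ∈ α.imageOf (A l), a < b))) :
    ∃ ω₁ ω₂ : PartialInj n,
      ω₁ ∈ Subsemigroup.closure (Jset n) ∧ ω₂ ∈ Subsemigroup.closure (Jset n) ∧
      ω₁.inv ∈ Subsemigroup.closure (Jset n) ∧ ω₂.inv ∈ Subsemigroup.closure (Jset n) ∧
      α.dom ⊆ ω₁.im ∧ α.im ⊆ ω₂.dom ∧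
      (ω₁ * α * ω₂) ∈ IFset n ∧
      (∀ q ∈ (ω₁ * α * ω₂).graph, q.2 % 2 = q.1 % 2) ∧
      ∃ A' : ℕ → Set ℕ,
        (∀ j, 1 ≤ j → j < i → A' j = A j) ∧
        (∀ j, 1 ≤ j → j ≤ p → IsBlock n (ω₁ * α * ω₂).dom (A' j)) ∧
        (∀ j j', 1 ≤ j → j < j' → j' ≤ p → ∀ a ∈ A' j, ∀ b ∈ A' j', a < b) ∧
        (∀ C, IsBlock n (ω₁ * α * ω₂).dom C → ∃ j, 1 ≤ j ∧ j ≤ p ∧ C = A' j) ∧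
        (1 < i →
          (∀ j, 1 ≤ j → j < i → ∀ x ∈ A j, (x, x) ∈ (ω₁ * α * ω₂).graph) ∧
          (∀ C, IsBlock n (ω₁ * α * ω₂).im C →
            ¬((∀ a ∈ A (i - 1), ∀ c ∈ C, a < c) ∧
              (∀ c ∈ C, ∀ b ∈ (ω₁ * α * ω₂).imageOf (A' i), c < b)))) ∧
        (∀ l, i < l → l ≤ p → ∀ b ∈ (ω₁ * α * ω₂).imageOf (A' i),
          ∀ c ∈ (ω₁ * α * ω₂).imageOf (A' l), b < c) := by
  have hsep : ∀ j l, 1 ≤ j → j < i → i ≤ l → l ≤ p → ∀ a ∈ A j, ∀ b ∈ α.imageOf (A l), a < b := by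
    intro j l h1 h2 h3 h4 a ha b hb
    rcases hcase with rfl | ⟨-, hcase⟩
    · omega
    · by_cases he : j = i - 1
      · exact hcase l h3 h4 a (he ▸ ha) b hb
      · obtain ⟨s, r, -, hA, -, -, -⟩ := hblocks (i - 1) (by omega) (by omega)
        have hs : s ∈ A (i - 1) := by rw [hA]; exact ⟨le_rfl, by omega⟩
        have := hmono j (i - 1) h1 (by omega) (by omega) a ha s hs
        have := hcase l h3 h4 s hs b hb
        omega
  have hfixed : ∀ j, 1 ≤ j → j < i → ∀ x ∈ A j, (x, x) ∈ α.graph := by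
    intro j h1 h2
    rcases hcase with rfl | ⟨hcase, -⟩
    · omega
    · exact hcase j h1 h2
  obtain ⟨ω₁, ω₂, A', hω₁, hω₂, hdom, him, hβ, hagree, hlt⟩ :=
    IdBefore.exists_image_first ⟨hα, hpar, ⟨hblocks, hmono, hcover⟩, hfixed, hsep⟩ hi1 hip
  refine ⟨ω₁, ω₂, hω₁.1, hω₂.1, hω₁.2, hω₂.2, hdom, him, hβ.mem, hβ.parity, A', hagree,
    hβ.blocks.isBlock, hβ.blocks.mono, hβ.blocks.cover, fun hi => ⟨?_, fun C hC => ?_⟩, hlt⟩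
  · intro j h1 h2 x hx
    exact hβ.fixed j h1 h2 x (by rwa [hagree j h1 h2])
  · rw [← hagree (i - 1) (by omega) (by omega)]
    exact hβ.not_isBlock_between hi hip hlt hC

end FencePaper
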